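/- For any two edges e, f of H, every monomorphism φ : V(H_{ef}) → V(H) is the identity. (Property (iv) of the main construction.) -/

import Mathlib

open Finset

/-- Edge r = {z, v1, v3, v5, v8} (z is vertex 0, vᵢ is vertex i). -/
def er : Finset (Fin 10) := {0, 1, 3, 5, 8}
/-- Edge g = {z, v2, v4, v7, v9}. -/
def eg : Finset (Fin 10) := {0, 2, 4, 7, 9}
/-- Edge a = {v1, v4, v6, v8, v9}. -/
def ea : Finset (Fin 10) := {1, 4, 6, 8, 9}
/-- Edge b = {v9, v1, v2, v3, v4}. -/
def eb : Finset (Fin 10) := {9, 1, 2, 3, 4}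
def ee1 : Finset (Fin 10) := {1, 2, 3, 4, 5}
def ee2 : Finset (Fin 10) := {2, 3, 4, 5, 6}
def ee3 : Finset (Fin 10) := {3, 4, 5, 6, 7}
def ee4 : Finset (Fin 10) := {4, 5, 6, 7, 8}
def ee5 : Finset (Fin 10) := {5, 6, 7, 8, 9}

/-- The edge set of the 5-uniform hypergraph H. -/
def Hedges : Finset (Finset (Fin 10)) := {er, eg, ea, eb, ee1, ee2, ee3, ee4, ee5}

/-- Degree of a vertex with respect to an edge set. -/
def deg (E : Finset (Finset (Fin 10))) (x : Fin 10) : ℕ :=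
  (E.filter (fun s => x ∈ s)).card

/-- The edges of `H`, indexed by `0, ..., 8`. -/
def edgeAt : ℕ → Finset (Fin 10)
  | 0 => er
  | 1 => eg
  | 2 => ea
  | 3 => eb
  | 4 => ee1
  | 5 => ee2
  | 6 => ee3
  | 7 => ee4
  | _ => ee5

/-- Table of the intersection sizes, packed in a number (4 bits for each entry). -/
def interSize (i j : ℕ) : ℕ := (11240041027681246211845293807016928480447127380432814840615137078071957561804808197804451573211669 >>> (4 * (9 * i + j))) % 16

/-- Incidence table, packed in a number (1 bit for each entry). -/
def incid (i x : ℕ) : ℕ := (1199840272565801460842517803 >>> (10 * i + x)) % 2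

/-- The vertex `x` cannot be mapped to `y`, given the images of the edges listed in `acc`. -/
def incompat (acc : List (ℕ × ℕ)) (x y : ℕ) : Bool :=
  acc.any fun p => !(Nat.beq (incid p.1 x) (incid p.2 y))

def verts : List ℕ := [0, 1, 2, 3, 4, 5, 6, 7, 8, 9]

/-- The edge images in `acc` are contradictory, or force the identity. -/
def leafOk (acc : List (ℕ × ℕ)) : Bool :=
  (verts.any fun x => verts.all fun y => incompat acc x y) ||
  (verts.all fun x => verts.all fun y => Nat.beq x y || incompat acc x y)

/-- Search over the possible images of the edges `n-1, ..., 0`, leaving out at most `skip`. -/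
def search : ℕ → List (ℕ × ℕ) → ℕ → Bool
  | 0, acc, _ => leafOk acc
  | n + 1, acc, skip =>
    (Nat.beq skip 0 || search n acc (skip - 1)) &&
    ([0, 1, 2, 3, 4, 5, 6, 7, 8] : List ℕ).all fun j =>
      !(acc.all fun p => Nat.beq (interSize p.1 n) (interSize p.2 j)) ||
        search n ((n, j) :: acc) skip

theorem search_run : search 9 [] 2 = true := by decide +kernel

theorem interSize_eq : ∀ i < 9, ∀ j < 9, (edgeAt i ∩ edgeAt j).card = interSize i j := by
  decide +kernel

theorem incid_eq : ∀ i < 9, ∀ x : Fin 10, incid i x = if x ∈ edgeAt i then 1 else 0 := by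
  decide +kernel

theorem mem_verts (x : Fin 10) : (x : ℕ) ∈ verts := by
  revert x; decide

theorem verts_lt : ∀ x ∈ verts, x < 10 := by decide

theorem exists_edgeAt (s : Finset (Fin 10)) (hs : s ∈ Hedges) : ∃ i < 9, s = edgeAt i := by
  simp only [Hedges, Finset.mem_insert, Finset.mem_singleton] at hs
  rcases hs with h | h | h | h | h | h | h | h | h
  exacts [⟨0, by norm_num, h⟩, ⟨1, by norm_num, h⟩, ⟨2, by norm_num, h⟩, ⟨3, by norm_num, h⟩,
    ⟨4, by norm_num, h⟩, ⟨5, by norm_num, h⟩, ⟨6, by norm_num, h⟩, ⟨7, by norm_num, h⟩,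
    ⟨8, by norm_num, h⟩]

theorem edgeAt_mem : ∀ i < 9, edgeAt i ∈ Hedges := by decide +kernel

theorem edgeAt_inj : ∀ i < 9, ∀ j < 9, edgeAt i = edgeAt j → i = j := by decide +kernel

/-- `acc` lists correct edge images. -/
def GoodAcc (φ : Fin 10 → Fin 10) (acc : List (ℕ × ℕ)) : Prop :=
  ∀ p ∈ acc, p.1 < 9 ∧ p.2 < 9 ∧ (edgeAt p.1).image φ = edgeAt p.2

theorem not_incompat (φ : Fin 10 → Fin 10) (hφ : Function.Injective φ) (acc : List (ℕ × ℕ))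
    (hacc : GoodAcc φ acc) (x : Fin 10) : incompat acc x (φ x) = false := by
  rw [incompat, List.any_eq_false]
  intro p hp
  obtain ⟨h1, h2, h3⟩ := hacc p hp
  have : incid p.1 x = incid p.2 (φ x) := by
    rw [incid_eq _ h1, incid_eq _ h2, ← h3]
    simp [hφ.eq_iff]
  simp [this]

theorem leafOk_sound (φ : Fin 10 → Fin 10) (hφ : Function.Injective φ) (acc : List (ℕ × ℕ))
    (hacc : GoodAcc φ acc) (h : leafOk acc = true) : φ = id := by
  rw [leafOk, Bool.or_eq_true, List.any_eq_true, List.all_eq_true] at h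
  rcases h with ⟨x, hx, h⟩ | h
  · rw [List.all_eq_true] at h
    have h' := h _ (mem_verts (φ ⟨x, verts_lt x hx⟩))
    have h2 := not_incompat φ hφ acc hacc ⟨x, verts_lt x hx⟩
    simp only at h2
    rw [h'] at h2
    exact absurd h2 (by simp)
  · funext x
    have h1 := h _ (mem_verts x)
    rw [List.all_eq_true] at h1
    have h2 := h1 _ (mem_verts (φ x))
    rw [not_incompat φ hφ acc hacc x, Bool.or_false] at h2
    exact (Fin.ext (Nat.eq_of_beq_eq_true h2)).symm

theorem search_sound (φ : Fin 10 → Fin 10) (hφ : Function.Injective φ) :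
    ∀ n ≤ 9, ∀ (acc : List (ℕ × ℕ)) (skip : ℕ), GoodAcc φ acc →
      ∀ B : Finset ℕ, (B ∩ Finset.range n).card ≤ skip →
      (∀ i < 9, i ∉ B → (edgeAt i).image φ ∈ Hedges) →
      search n acc skip = true → φ = id := by
  intro n
  induction n with
  | zero =>
    intro _ acc skip hacc B _ _ h
    exact leafOk_sound φ hφ acc hacc h
  | succ n ih =>
    intro hn acc skip hacc B hB hgood h
    rw [search, Bool.and_eq_true, Bool.or_eq_true, List.all_eq_true] at h
    obtain ⟨hs, hall⟩ := h
    by_cases hnB : n ∈ B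
    · have hc : (B ∩ Finset.range n).card + 1 ≤ (B ∩ Finset.range (n + 1)).card := by
        have : B ∩ Finset.range (n + 1) = insert n (B ∩ Finset.range n) := by
          ext k
          simp only [Finset.mem_inter, Finset.mem_range, Finset.mem_insert]
          constructor
          · rintro ⟨h1, h2⟩
            by_cases hk : k = n
            · exact Or.inl hk
            · exact Or.inr ⟨h1, by omega⟩
          · rintro (rfl | ⟨h1, h2⟩)
            · exact ⟨hnB, by omega⟩
            · exact ⟨h1, by omega⟩
        rw [this, Finset.card_insert_of_notMem (by simp)]
      rcases hs with hs | hs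
      · have := Nat.eq_of_beq_eq_true hs
        omega
      · exact ih (by omega) acc (skip - 1) hacc B (by omega) hgood hs
    · obtain ⟨j, hj, hij⟩ := exists_edgeAt _ (hgood n (by omega) hnB)
      have hj' : j ∈ ([0, 1, 2, 3, 4, 5, 6, 7, 8] : List ℕ) := by
        simp only [List.mem_cons, List.not_mem_nil, or_false]
        omega
      have h1 := hall j hj'
      have h2 : (acc.all fun p => Nat.beq (interSize p.1 n) (interSize p.2 j)) = true := by
        rw [List.all_eq_true]
        intro p hp
        obtain ⟨hp1, hp2, hp3⟩ := hacc p hp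
        have : interSize p.1 n = interSize p.2 j := by
          rw [← interSize_eq _ hp1 _ (by omega), ← interSize_eq _ hp2 _ hj, ← hp3, ← hij,
            ← Finset.image_inter _ _ hφ, Finset.card_image_of_injective _ hφ]
        simp [this]
      rw [h2, Bool.not_true, Bool.false_or] at h1
      refine ih (by omega) ((n, j) :: acc) skip ?_ B ?_ hgood h1
      · intro p hp
        rcases List.mem_cons.1 hp with rfl | hp
        · exact ⟨by simp only; omega, hj, hij⟩
        · exact hacc p hp
      · exact (Finset.card_le_card (Finset.inter_subset_inter_left
          (Finset.range_mono (Nat.le_succ n)))).trans hB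

theorem stmt18 (e f : Finset (Fin 10)) (he : e ∈ Hedges) (hf : f ∈ Hedges)
    (φ : Fin 10 → Fin 10) (hφ : Function.Injective φ)
    (hmono : ∀ s ∈ Hedges \ {e, f}, s.image φ ∈ Hedges) :
    φ = id := by
  obtain ⟨i, hi, rfl⟩ := exists_edgeAt e he
  obtain ⟨j, hj, rfl⟩ := exists_edgeAt f hf
  refine search_sound φ hφ 9 le_rfl [] 2 (by intro p hp; simp at hp) {i, j} ?_ ?_ search_run
  · exact (Finset.card_le_card Finset.inter_subset_left).trans Finset.card_le_two
  · intro k hk hkB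
    apply hmono
    simp only [Finset.mem_sdiff, Finset.mem_insert, Finset.mem_singleton, not_or] at hkB ⊢
    exact ⟨edgeAt_mem k hk, fun h => hkB.1 (edgeAt_inj k hk i hi h),
      fun h => hkB.2 (edgeAt_inj k hk j hj h)⟩
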